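/- Let g = 17 be the 7-dimensional 2-step nilpotent real Lie algebra with basis e1,…,e7 and only nonzero brackets [e1,e2] = −e7, [e3,e4] = −e7, [e5,e6] = −e7 (up to antisymmetry). Then: (i) the space of closed alternating 4-forms on g has dimension 29; (ii) the space of derivations of g has dimension 28; (iii) the 4-form ψ = −(1/2)e^{1234}+e^{1256}+e^{1357}+e^{1467}−e^{2367}+e^{2457}−(1/2)e^{3456} is closed and the space of derivations stabilizing ψ has dimension 4; (iv) there exists δ > 0 such that for every real ε with 0 < |ε| < δ, the space of derivations of g stabilizing ψ_ε := ψ + ε·e^{1234} has dimension 2. -/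

import Mathlib

noncomputable section

/-- The underlying 7-dimensional real vector space. -/
abbrev V : Type := Fin 7 → ℝ

/-- The Lie bracket of the 2-step nilpotent Lie algebra `17` ([e1,e2] = [e3,e4] = [e5,e6] = -e7), extended bilinearly from the structure constants. -/
def bk (x y : V) : V :=
  ![0, 0, 0, 0, 0, 0, -(x 0 * y 1 - x 1 * y 0) - (x 2 * y 3 - x 3 * y 2) - (x 4 * y 5 - x 5 * y 4)]

/-- The alternating 4-form `e^i ∧ e^j ∧ e^k ∧ e^l` on `V`. -/
def w4 (i j k l : Fin 7) : AlternatingMap ℝ V ℝ (Fin 4) :=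
  (Matrix.detRowAlternating : AlternatingMap ℝ (Fin 4 → ℝ) ℝ (Fin 4)).compLinearMap
    (LinearMap.pi (fun a => LinearMap.proj (![i, j, k, l] a)))

/-- Chevalley–Eilenberg differential of a 4-form, as a scalar-valued function. -/
def d4 (ψ : AlternatingMap ℝ V ℝ (Fin 4)) (x₀ x₁ x₂ x₃ x₄ : V) : ℝ :=
  -(ψ ![bk x₀ x₁, x₂, x₃, x₄]) + ψ ![bk x₀ x₂, x₁, x₃, x₄] - ψ ![bk x₀ x₃, x₁, x₂, x₄]
    + ψ ![bk x₀ x₄, x₁, x₂, x₃] - ψ ![bk x₁ x₂, x₀, x₃, x₄] + ψ ![bk x₁ x₃, x₀, x₂, x₄]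
    - ψ ![bk x₁ x₄, x₀, x₂, x₃] - ψ ![bk x₂ x₃, x₀, x₁, x₄] + ψ ![bk x₂ x₄, x₀, x₁, x₃]
    - ψ ![bk x₃ x₄, x₀, x₁, x₂]

/-- A 4-form is closed if its Chevalley–Eilenberg differential vanishes. -/
def Closed4 (ψ : AlternatingMap ℝ V ℝ (Fin 4)) : Prop :=
  ∀ x₀ x₁ x₂ x₃ x₄ : V, d4 ψ x₀ x₁ x₂ x₃ x₄ = 0

/-- A linear map `D : V → V` is a derivation of the Lie algebra `(V, bk)`. -/
def IsDeriv (D : V →ₗ[ℝ] V) : Prop :=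
  ∀ x y : V, D (bk x y) = bk (D x) y + bk x (D y)

/-- `D` stabilizes (annihilates infinitesimally) the 4-form `ψ`. -/
def Stab4 (ψ : AlternatingMap ℝ V ℝ (Fin 4)) (D : V →ₗ[ℝ] V) : Prop :=
  ∀ x y z w : V, ψ ![D x, y, z, w] + ψ ![x, D y, z, w] + ψ ![x, y, D z, w] + ψ ![x, y, z, D w] = 0

/-- The distinguished 4-form. -/
def psi : AlternatingMap ℝ V ℝ (Fin 4) :=
  (-(1/2) : ℝ) • w4 0 1 2 3 + w4 0 1 4 5 + w4 0 2 4 6 + w4 0 3 5 6 - w4 1 2 5 6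
    + w4 1 3 4 6 - ((1/2) : ℝ) • w4 2 3 4 5

/-- The perturbation 4-form. -/
def eta : AlternatingMap ℝ V ℝ (Fin 4) :=
  w4 0 1 2 3

/-- Alternating maps agreeing on strictly increasing families of basis vectors are equal. -/
theorem Module.Basis.ext_alternating_of_strictMono {R M N ι : Type*} [CommRing R] [AddCommGroup M]
    [Module R M] [AddCommGroup N] [Module R N] [LinearOrder ι] {n : ℕ} (e : Module.Basis ι R M)
    {f g : M [⋀^Fin n]→ₗ[R] N}
    (h : ∀ v : Fin n → ι, StrictMono v → f (e ∘ v) = g (e ∘ v)) : f = g := by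
  refine e.ext_alternating fun v hv => ?_
  have hs := h (v ∘ Tuple.sort v)
    ((Tuple.monotone_sort v).strictMono_of_injective (hv.comp (Tuple.sort v).injective))
  have hf := f.map_perm (e ∘ v) (Tuple.sort v)
  have hg := g.map_perm (e ∘ v) (Tuple.sort v)
  rw [← Function.comp_assoc] at hs
  change f ((e ∘ v) ∘ _) = _ at hf
  change g ((e ∘ v) ∘ _) = _ at hg
  rw [hf, hg] at hs
  exact smul_left_cancel _ hs

section Slots

variable (ψ : AlternatingMap ℝ V ℝ (Fin 4)) (a b c d x : V) (r : ℝ)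

lemma update_vec₀ : Function.update ![a, b, c, d] 0 x = ![x, b, c, d] := by
  ext i : 1; fin_cases i <;> rfl

lemma update_vec₁ : Function.update ![a, b, c, d] 1 x = ![a, x, c, d] := by
  ext i : 1; fin_cases i <;> rfl

lemma update_vec₂ : Function.update ![a, b, c, d] 2 x = ![a, b, x, d] := by
  ext i : 1; fin_cases i <;> rfl

lemma update_vec₃ : Function.update ![a, b, c, d] 3 x = ![a, b, c, x] := by
  ext i : 1; fin_cases i <;> rfl

lemma map_add_slot₀ : ψ ![a + x, b, c, d] = ψ ![a, b, c, d] + ψ ![x, b, c, d] := by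
  simpa only [update_vec₀] using ψ.map_update_add ![a, b, c, d] 0 a x

lemma map_add_slot₁ : ψ ![a, b + x, c, d] = ψ ![a, b, c, d] + ψ ![a, x, c, d] := by
  simpa only [update_vec₁] using ψ.map_update_add ![a, b, c, d] 1 b x

lemma map_add_slot₂ : ψ ![a, b, c + x, d] = ψ ![a, b, c, d] + ψ ![a, b, x, d] := by
  simpa only [update_vec₂] using ψ.map_update_add ![a, b, c, d] 2 c x

lemma map_add_slot₃ : ψ ![a, b, c, d + x] = ψ ![a, b, c, d] + ψ ![a, b, c, x] := by
  simpa only [update_vec₃] using ψ.map_update_add ![a, b, c, d] 3 d x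

lemma map_smul_slot₀ : ψ ![r • a, b, c, d] = r * ψ ![a, b, c, d] := by
  simpa only [update_vec₀, smul_eq_mul] using ψ.map_update_smul ![a, b, c, d] 0 r a

lemma map_smul_slot₁ : ψ ![a, r • b, c, d] = r * ψ ![a, b, c, d] := by
  simpa only [update_vec₁, smul_eq_mul] using ψ.map_update_smul ![a, b, c, d] 1 r b

lemma map_smul_slot₂ : ψ ![a, b, r • c, d] = r * ψ ![a, b, c, d] := by
  simpa only [update_vec₂, smul_eq_mul] using ψ.map_update_smul ![a, b, c, d] 2 r c

lemma map_smul_slot₃ : ψ ![a, b, c, r • d] = r * ψ ![a, b, c, d] := by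
  simpa only [update_vec₃, smul_eq_mul] using ψ.map_update_smul ![a, b, c, d] 3 r d

lemma map_swap_slot₀₁ : ψ ![b, a, c, d] = -ψ ![a, b, c, d] := by
  rw [← ψ.map_swap ![a, b, c, d] (show (0 : Fin 4) ≠ 1 by decide)]
  congr 1; ext i j; fin_cases i <;> rfl

lemma map_swap_slot₁₂ : ψ ![a, c, b, d] = -ψ ![a, b, c, d] := by
  rw [← ψ.map_swap ![a, b, c, d] (show (1 : Fin 4) ≠ 2 by decide)]
  congr 1; ext i j; fin_cases i <;> rfl

lemma map_swap_slot₂₃ : ψ ![a, b, d, c] = -ψ ![a, b, c, d] := by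
  rw [← ψ.map_swap ![a, b, c, d] (show (2 : Fin 4) ≠ 3 by decide)]
  congr 1; ext i j; fin_cases i <;> rfl

end Slots

lemma bk_add_left (x y z : V) : bk (x + y) z = bk x z + bk y z := by
  ext i; fin_cases i <;> simp [bk]; ring

lemma bk_add_right (x y z : V) : bk x (y + z) = bk x y + bk x z := by
  ext i; fin_cases i <;> simp [bk]; ring

lemma bk_smul_left (r : ℝ) (x y : V) : bk (r • x) y = r • bk x y := by
  ext i; fin_cases i <;> simp [bk]; ring

lemma bk_smul_right (r : ℝ) (x y : V) : bk x (r • y) = r • bk x y := by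
  ext i; fin_cases i <;> simp [bk]; ring

lemma bk_swap (x y : V) : bk y x = (-1 : ℝ) • bk x y := by
  ext i; fin_cases i <;> simp [bk]; ring

lemma bk_self (x : V) : bk x x = 0 := by
  ext i; fin_cases i <;> simp [bk]; ring

/-- A function that changes sign under adjacent transpositions vanishes when two arguments agree. -/
theorem eq_zero_of_swap_castSucc_succ {α : Type*} {n : ℕ} {f : (Fin (n + 1) → α) → ℝ}
    (hf : ∀ v (i : Fin n), f (v ∘ Equiv.swap i.castSucc i.succ) = -f v)
    {v : Fin (n + 1) → α} {i j : Fin (n + 1)} (hv : v i = v j) (hij : i ≠ j) : f v = 0 := by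
  have key : ∀ σ : Equiv.Perm (Fin (n + 1)), ∀ v, f (v ∘ σ) = (Equiv.Perm.sign σ : ℤ) * f v := by
    intro σ
    have hσ : σ ∈ Submonoid.closure
        (Set.range fun i : Fin n ↦ Equiv.swap i.castSucc i.succ) := by
      rw [Equiv.Perm.mclosure_swap_castSucc_succ]; trivial
    induction hσ using Submonoid.closure_induction with
    | mem x hx =>
      obtain ⟨i, rfl⟩ := hx
      intro v
      simp [hf, Equiv.Perm.sign_swap (Fin.castSucc_lt_succ (i := i)).ne]
    | one => simp
    | mul x y _ _ hx hy =>
      intro v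
      rw [Equiv.Perm.coe_mul, ← Function.comp_assoc, hy, hx]
      simp [mul_left_comm, mul_assoc]
  have h := key (Equiv.swap i j) v
  have hswap : v ∘ Equiv.swap i j = v := by
    ext k
    rcases eq_or_ne k i with rfl | hi
    · simp [hv]
    rcases eq_or_ne k j with rfl | hj
    · simp [hv]
    simp [Equiv.swap_apply_of_ne_of_ne hi hj]
  rw [hswap, Equiv.Perm.sign_swap hij] at h
  simp at h
  linarith

/-- The infinitesimal action of an endomorphism `D` on a 4-form, as an alternating map. -/
def stabForm (ψ : AlternatingMap ℝ V ℝ (Fin 4)) (D : V →ₗ[ℝ] V) :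
    AlternatingMap ℝ V ℝ (Fin 4) where
  toMultilinearMap := MultilinearMap.mk' (fun v => ψ ![D (v 0), v 1, v 2, v 3] +
    ψ ![v 0, D (v 1), v 2, v 3] + ψ ![v 0, v 1, D (v 2), v 3] + ψ ![v 0, v 1, v 2, D (v 3)])
    (by
      intro v i x y
      fin_cases i <;> simp [map_add_slot₀, map_add_slot₁, map_add_slot₂, map_add_slot₃] <;> ring)
    (by
      intro v i r x
      fin_cases i <;> simp [map_smul_slot₀, map_smul_slot₁, map_smul_slot₂, map_smul_slot₃] <;>
        ring)
  map_eq_zero_of_eq' := by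
    intro v i j hv hij
    refine eq_zero_of_swap_castSucc_succ (fun v i => ?_) hv hij
    fin_cases i <;> simp [Equiv.swap_apply_def]
    · rw [map_swap_slot₀₁ ψ (v 0) (D (v 1)), map_swap_slot₀₁ ψ (D (v 0)) (v 1),
        map_swap_slot₀₁ ψ (v 0) (v 1), map_swap_slot₀₁ ψ (v 0) (v 1)]
      ring
    · rw [map_swap_slot₁₂ ψ _ (v 1) (D (v 2)), map_swap_slot₁₂ ψ _ (D (v 1)) (v 2),
        map_swap_slot₁₂ ψ _ (v 1) (v 2), map_swap_slot₁₂ ψ _ (v 1) (v 2)]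
      ring
    · rw [map_swap_slot₂₃ ψ _ _ (v 2) (D (v 3)), map_swap_slot₂₃ ψ _ _ (D (v 2)) (v 3),
        map_swap_slot₂₃ ψ _ _ (v 2) (v 3), map_swap_slot₂₃ ψ _ _ (v 2) (v 3)]
      ring

/-- The Chevalley–Eilenberg differential of a 4-form, as an alternating map. -/
def d4Form (ψ : AlternatingMap ℝ V ℝ (Fin 4)) : AlternatingMap ℝ V ℝ (Fin 5) where
  toMultilinearMap := MultilinearMap.mk' (fun v => d4 ψ (v 0) (v 1) (v 2) (v 3) (v 4))
    (by
      intro v i x y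
      fin_cases i <;> simp [d4, bk_add_left, bk_add_right, map_add_slot₀, map_add_slot₁,
        map_add_slot₂, map_add_slot₃] <;> ring)
    (by
      intro v i r x
      fin_cases i <;> simp [d4, bk_smul_left, bk_smul_right, map_smul_slot₀, map_smul_slot₁,
        map_smul_slot₂, map_smul_slot₃] <;> ring)
  map_eq_zero_of_eq' := by
    intro v i j hv hij
    refine eq_zero_of_swap_castSucc_succ (fun v i => ?_) hv hij
    fin_cases i <;> simp [d4, Equiv.swap_apply_def]
    · rw [bk_swap (v 0) (v 1), map_smul_slot₀, map_swap_slot₁₂ ψ _ (v 0) (v 1),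
        map_swap_slot₁₂ ψ _ (v 0) (v 1), map_swap_slot₁₂ ψ _ (v 0) (v 1)]
      ring
    · rw [bk_swap (v 1) (v 2), map_smul_slot₀, map_swap_slot₁₂ ψ _ (v 1) (v 2),
        map_swap_slot₁₂ ψ _ (v 1) (v 2), map_swap_slot₂₃ ψ _ _ (v 1) (v 2)]
      ring
    · rw [bk_swap (v 2) (v 3), map_smul_slot₀, map_swap_slot₂₃ ψ _ _ (v 2) (v 3),
        map_swap_slot₂₃ ψ _ _ (v 2) (v 3), map_swap_slot₁₂ ψ _ (v 2) (v 3)]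
      ring
    · rw [bk_swap (v 3) (v 4), map_smul_slot₀, map_swap_slot₂₃ ψ _ _ (v 3) (v 4),
        map_swap_slot₂₃ ψ _ _ (v 3) (v 4), map_swap_slot₂₃ ψ _ _ (v 3) (v 4)]
      ring

lemma w4_apply (i j k l : Fin 7) (x y z t : V) : w4 i j k l ![x, y, z, t] =
    (x i * y j - x j * y i) * (z k * t l - z l * t k) -
    (x i * y k - x k * y i) * (z j * t l - z l * t j) +
    (x i * y l - x l * y i) * (z j * t k - z k * t j) +
    (x j * y k - x k * y j) * (z i * t l - z l * t i) -
    (x j * y l - x l * y j) * (z i * t k - z k * t i) +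
    (x k * y l - x l * y k) * (z i * t j - z j * t i) := by
  change Matrix.det (Matrix.of fun r c : Fin 4 => (![x, y, z, t] r) (![i, j, k, l] c)) = _
  simp [Matrix.det_succ_row_zero, Fin.sum_univ_succ, Fin.succAbove]
  ring

lemma bk_eq_smul (x y : V) : bk x y =
    (-(x 0 * y 1 - x 1 * y 0) - (x 2 * y 3 - x 3 * y 2) - (x 4 * y 5 - x 5 * y 4)) •
      (Pi.single 6 1 : V) := by
  ext i; fin_cases i <;> simp [bk]

lemma d4_eq_zero_of_basis {ψ : AlternatingMap ℝ V ℝ (Fin 4)}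
    (h : ∀ a b c d e : Fin 7, a < b → b < c → c < d → d < e →
      d4 ψ (Pi.single a 1) (Pi.single b 1) (Pi.single c 1) (Pi.single d 1) (Pi.single e 1) = 0) :
    Closed4 ψ := by
  have : d4Form ψ = 0 := by
    refine (Pi.basisFun ℝ (Fin 7)).ext_alternating_of_strictMono fun v hv => ?_
    simpa [d4Form] using h (v 0) (v 1) (v 2) (v 3) (v 4) (hv (by decide)) (hv (by decide))
      (hv (by decide)) (hv (by decide))
  intro x₀ x₁ x₂ x₃ x₄
  simpa [d4Form] using DFunLike.congr_fun this ![x₀, x₁, x₂, x₃, x₄]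

lemma stab4_of_basis {ψ : AlternatingMap ℝ V ℝ (Fin 4)} {D : V →ₗ[ℝ] V}
    (h : ∀ a b c d : Fin 7, a < b → b < c → c < d →
      ψ ![D (Pi.single a 1), Pi.single b 1, Pi.single c 1, Pi.single d 1] +
      ψ ![Pi.single a 1, D (Pi.single b 1), Pi.single c 1, Pi.single d 1] +
      ψ ![Pi.single a 1, Pi.single b 1, D (Pi.single c 1), Pi.single d 1] +
      ψ ![Pi.single a 1, Pi.single b 1, Pi.single c 1, D (Pi.single d 1)] = 0) :
    Stab4 ψ D := by
  have : stabForm ψ D = 0 := by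
    refine (Pi.basisFun ℝ (Fin 7)).ext_alternating_of_strictMono fun v hv => ?_
    simpa [stabForm] using h (v 0) (v 1) (v 2) (v 3) (hv (by decide)) (hv (by decide))
      (hv (by decide))
  intro x y z w
  simpa [stabForm] using DFunLike.congr_fun this ![x, y, z, w]

/-- The value of the differential on five fixed vectors, as a linear functional of the 4-form. -/
def d4Lin (x₀ x₁ x₂ x₃ x₄ : V) : AlternatingMap ℝ V ℝ (Fin 4) →ₗ[ℝ] ℝ where
  toFun ψ := d4 ψ x₀ x₁ x₂ x₃ x₄
  map_add' ψ φ := by simp [d4]; ring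
  map_smul' r ψ := by simp [d4]; ring

/-- The coordinates of the differential on the five-element subsets of `e₁, …, e₆`. -/
def d4Coords : AlternatingMap ℝ V ℝ (Fin 4) →ₗ[ℝ] (Fin 6 → ℝ) :=
  LinearMap.pi fun k =>
    let e (i : Fin 5) : V := Pi.single (k.succAbove i).castSucc 1
    d4Lin (e 0) (e 1) (e 2) (e 3) (e 4)

lemma d4Coords_surjective : Function.Surjective d4Coords := by
  intro y
  refine ⟨-(y 0 • w4 1 2 3 6 + y 1 • w4 0 2 3 6 + y 2 • w4 0 1 3 6 + y 3 • w4 0 1 2 6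
    + y 4 • w4 0 1 5 6 + y 5 • w4 0 1 4 6), ?_⟩
  ext k
  fin_cases k <;>
    simp [d4Coords, d4Lin, d4, Fin.succAbove, bk_eq_smul, map_smul_slot₀, w4_apply, Pi.single_apply]

lemma map_self_slot₀₃ (ψ : AlternatingMap ℝ V ℝ (Fin 4)) (a b c : V) : ψ ![a, b, c, a] = 0 :=
  ψ.map_eq_zero_of_eq _ (i := 0) (j := 3) rfl (by decide)

lemma map_zero_slot₀ (ψ : AlternatingMap ℝ V ℝ (Fin 4)) (a b c : V) : ψ ![0, a, b, c] = 0 :=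
  ψ.map_coord_zero 0 rfl

lemma mem_ker_d4Coords {ψ : AlternatingMap ℝ V ℝ (Fin 4)} :
    ψ ∈ LinearMap.ker d4Coords ↔ Closed4 ψ := by
  refine ⟨fun h => d4_eq_zero_of_basis fun a b c d e hab hbc hcd hde => ?_, fun h => ?_⟩
  · rw [LinearMap.mem_ker] at h
    rcases eq_or_ne e 6 with rfl | he
    · have ha := hab.trans (hbc.trans (hcd.trans hde))
      have hb := hbc.trans (hcd.trans hde)
      have hc := hcd.trans hde
      simp [d4, bk_eq_smul, map_smul_slot₀, map_self_slot₀₃, map_zero_slot₀]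
    · have key : ∀ a b c d e : Fin 7, a < b → b < c → c < d → d < e → e ≠ 6 → ∃ k : Fin 6,
          (k.succAbove (0 : Fin 5)).castSucc = a ∧ (k.succAbove (1 : Fin 5)).castSucc = b ∧
          (k.succAbove (2 : Fin 5)).castSucc = c ∧ (k.succAbove (3 : Fin 5)).castSucc = d ∧
          (k.succAbove (4 : Fin 5)).castSucc = e := by decide
      obtain ⟨k, rfl, rfl, rfl, rfl, rfl⟩ := key a b c d e hab hbc hcd hde he
      exact congrFun h k
  · rw [LinearMap.mem_ker]
    ext k
    exact h _ _ _ _ _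

lemma finrank_alternatingMap :
    Module.finrank ℝ (AlternatingMap ℝ V ℝ (Fin 4)) = 35 := by
  rw [LinearEquiv.finrank_eq (exteriorPower.alternatingMapLinearEquiv (R := ℝ) (M := V) (N := ℝ)
    (n := 4))]
  change Module.finrank ℝ (Module.Dual ℝ _) = 35
  rw [Subspace.dual_finrank_eq, exteriorPower.finrank_eq, Module.finrank_fin_fun]
  rfl

lemma finrank_ker_d4Coords : Module.finrank ℝ (LinearMap.ker d4Coords) = 29 := by
  have : FiniteDimensional ℝ (AlternatingMap ℝ V ℝ (Fin 4)) :=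
    Module.finite_of_finrank_pos (by rw [finrank_alternatingMap]; norm_num)
  have h := d4Coords.finrank_range_add_finrank_ker
  rw [LinearMap.range_eq_top.mpr d4Coords_surjective, finrank_top, finrank_alternatingMap,
    Module.finrank_fin_fun] at h
  omega

lemma closed4_psi : Closed4 psi := by
  rw [← mem_ker_d4Coords, LinearMap.mem_ker]
  ext k
  fin_cases k <;>
    simp [psi, d4Coords, d4Lin, d4, Fin.succAbove, bk_eq_smul, map_smul_slot₀, w4_apply,
      Pi.single_apply]

lemma map_eq_sum (D : V →ₗ[ℝ] V) (v : V) (i : Fin 7) :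
    D v i = ∑ j, v j * D (Pi.single j 1) i := by
  conv_lhs => rw [← Finset.univ_sum_single v, map_sum]
  rw [Finset.sum_apply]
  refine Finset.sum_congr rfl fun j _ => ?_
  rw [← smul_eq_mul, ← Pi.smul_apply, ← map_smul, ← Pi.single_smul, smul_eq_mul, mul_one]

lemma isDeriv_iff {D : V →ₗ[ℝ] V} : IsDeriv D ↔
    D (Pi.single 6 1) 0 = 0 ∧
    D (Pi.single 6 1) 1 = 0 ∧
    D (Pi.single 6 1) 2 = 0 ∧
    D (Pi.single 6 1) 3 = 0 ∧
    D (Pi.single 6 1) 4 = 0 ∧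
    D (Pi.single 6 1) 5 = 0 ∧
    D (Pi.single 0 1) 0 + D (Pi.single 1 1) 1 = D (Pi.single 6 1) 6 ∧
    D (Pi.single 2 1) 1 - D (Pi.single 0 1) 3 = 0 ∧
    D (Pi.single 3 1) 1 + D (Pi.single 0 1) 2 = 0 ∧
    D (Pi.single 4 1) 1 - D (Pi.single 0 1) 5 = 0 ∧
    D (Pi.single 5 1) 1 + D (Pi.single 0 1) 4 = 0 ∧
    -D (Pi.single 2 1) 0 - D (Pi.single 1 1) 3 = 0 ∧
    -D (Pi.single 3 1) 0 + D (Pi.single 1 1) 2 = 0 ∧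
    -D (Pi.single 4 1) 0 - D (Pi.single 1 1) 5 = 0 ∧
    -D (Pi.single 5 1) 0 + D (Pi.single 1 1) 4 = 0 ∧
    D (Pi.single 2 1) 2 + D (Pi.single 3 1) 3 = D (Pi.single 6 1) 6 ∧
    D (Pi.single 4 1) 3 - D (Pi.single 2 1) 5 = 0 ∧
    D (Pi.single 5 1) 3 + D (Pi.single 2 1) 4 = 0 ∧
    -D (Pi.single 4 1) 2 - D (Pi.single 3 1) 5 = 0 ∧
    -D (Pi.single 5 1) 2 + D (Pi.single 3 1) 4 = 0 ∧
    D (Pi.single 4 1) 4 + D (Pi.single 5 1) 5 = D (Pi.single 6 1) 6 := by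
  constructor
  · intro h
    have key (i j k : Fin 7) := congrFun (h (Pi.single i 1) (Pi.single j 1)) k
    refine ⟨?_, ?_, ?_, ?_, ?_, ?_, ?_, ?_, ?_, ?_, ?_, ?_, ?_, ?_, ?_, ?_, ?_, ?_, ?_, ?_, ?_⟩
    · simpa [bk_eq_smul, Pi.single_apply] using key 0 1 0
    · simpa [bk_eq_smul, Pi.single_apply] using key 0 1 1
    · simpa [bk_eq_smul, Pi.single_apply] using key 0 1 2
    · simpa [bk_eq_smul, Pi.single_apply] using key 0 1 3
    · simpa [bk_eq_smul, Pi.single_apply] using key 0 1 4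
    · simpa [bk_eq_smul, Pi.single_apply] using key 0 1 5
    · have := key 0 1 6
      simp [bk_eq_smul] at this
      linarith
    · have := key 0 2 6
      simp [bk_eq_smul] at this
      linarith
    · have := key 0 3 6
      simp [bk_eq_smul] at this
      linarith
    · have := key 0 4 6
      simp [bk_eq_smul] at this
      linarith
    · have := key 0 5 6
      simp [bk_eq_smul] at this
      linarith
    · have := key 1 2 6
      simp [bk_eq_smul] at this
      linarith
    · have := key 1 3 6
      simp [bk_eq_smul] at this
      linarith
    · have := key 1 4 6
      simp [bk_eq_smul] at this
      linarith
    · have := key 1 5 6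
      simp [bk_eq_smul] at this
      linarith
    · have := key 2 3 6
      simp [bk_eq_smul] at this
      linarith
    · have := key 2 4 6
      simp [bk_eq_smul] at this
      linarith
    · have := key 2 5 6
      simp [bk_eq_smul] at this
      linarith
    · have := key 3 4 6
      simp [bk_eq_smul] at this
      linarith
    · have := key 3 5 6
      simp [bk_eq_smul] at this
      linarith
    · have := key 4 5 6
      simp [bk_eq_smul] at this
      linarith
  · rintro ⟨z0, z1, z2, z3, z4, z5, h01, h02, h03, h04, h05, h12, h13, h14, h15, h23, h24, h25,
    h34, h35, h45⟩ x y
    rw [bk_eq_smul, map_smul]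
    ext i
    fin_cases i
    iterate 6 simp [bk, z0, z1, z2, z3, z4, z5]
    simp [bk]
    simp only [map_eq_sum D x, map_eq_sum D y, Fin.sum_univ_succ]
    simp [z0, z1, z2, z3, z4, z5]
    linear_combination (x 0 * y 1 - x 1 * y 0) * h01 + (x 0 * y 2 - x 2 * y 0) * h02 +
      (x 0 * y 3 - x 3 * y 0) * h03 + (x 0 * y 4 - x 4 * y 0) * h04 +
      (x 0 * y 5 - x 5 * y 0) * h05 + (x 1 * y 2 - x 2 * y 1) * h12 +
      (x 1 * y 3 - x 3 * y 1) * h13 + (x 1 * y 4 - x 4 * y 1) * h14 +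
      (x 1 * y 5 - x 5 * y 1) * h15 + (x 2 * y 3 - x 3 * y 2) * h23 +
      (x 2 * y 4 - x 4 * y 2) * h24 + (x 2 * y 5 - x 5 * y 2) * h25 +
      (x 3 * y 4 - x 4 * y 3) * h34 + (x 3 * y 5 - x 5 * y 3) * h35 + (x 4 * y 5 - x 5 * y 4) * h45

/-- A property of endomorphisms parametrized linearly and bijectively by `Fin n → ℝ` cuts out a
subspace of dimension `n`. -/
theorem exists_submodule_of_param {n : ℕ} {P : (V →ₗ[ℝ] V) → Prop}
    (f : (Fin n → ℝ) →ₗ[ℝ] (V →ₗ[ℝ] V)) (g : (V →ₗ[ℝ] V) → Fin n → ℝ)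
    (hgf : Function.LeftInverse g f) (hf : ∀ p, P (f p)) (hg : ∀ D, P D → f (g D) = D) :
    ∃ S : Submodule ℝ (V →ₗ[ℝ] V), (∀ D, D ∈ S ↔ P D) ∧ Module.finrank ℝ S = n := by
  refine ⟨LinearMap.range f, fun D => ⟨?_, fun h => ⟨g D, hg D h⟩⟩, ?_⟩
  · rintro ⟨p, rfl⟩
    exact hf p
  · rw [LinearMap.finrank_range_of_inj hgf.injective, Module.finrank_fin_fun]

lemma end_ext {D E : V →ₗ[ℝ] V}
    (h : ∀ j i, D (Pi.single j 1) i = E (Pi.single j 1) i) : D = E :=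
  (Pi.basisFun ℝ (Fin 7)).ext fun j => by
    rw [Pi.basisFun_apply]
    exact funext (h j)

/-- The derivations of the Lie algebra, parametrized by their independent matrix entries. -/
def derivParam : (Fin 28 → ℝ) →ₗ[ℝ] (V →ₗ[ℝ] V) :=
  Matrix.toLin'.toLinearMap ∘ₗ
    { toFun p := !![-p 2 + p 27, p 0, -p 7, p 4, -p 16, p 11, 0;
        p 1, p 2, p 6, -p 3, p 15, -p 10, 0;
        p 3, p 4, -p 9 + p 27, p 5, -p 18, p 13, 0;
        p 6, p 7, p 8, p 9, p 17, -p 12, 0;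
        p 10, p 11, p 12, p 13, -p 20 + p 27, p 14, 0;
        p 15, p 16, p 17, p 18, p 19, p 20, 0;
        p 21, p 22, p 23, p 24, p 25, p 26, p 27]
      map_add' p q := by
        ext i j; fin_cases i <;> fin_cases j <;> simp <;> ring
      map_smul' r p := by
        ext i j; fin_cases i <;> fin_cases j <;> simp <;> ring }

lemma isDeriv_derivParam (p : Fin 28 → ℝ) : IsDeriv (derivParam p) := by
  rw [isDeriv_iff]
  simp [derivParam]

/-- The independent matrix entries of a derivation. -/
def derivCoords (D : V →ₗ[ℝ] V) : Fin 28 → ℝ :=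
  ![D (Pi.single 1 1) 0, D (Pi.single 0 1) 1, D (Pi.single 1 1) 1, D (Pi.single 0 1) 2,
    D (Pi.single 1 1) 2, D (Pi.single 3 1) 2, D (Pi.single 0 1) 3, D (Pi.single 1 1) 3,
    D (Pi.single 2 1) 3, D (Pi.single 3 1) 3, D (Pi.single 0 1) 4, D (Pi.single 1 1) 4,
    D (Pi.single 2 1) 4, D (Pi.single 3 1) 4, D (Pi.single 5 1) 4, D (Pi.single 0 1) 5,
    D (Pi.single 1 1) 5, D (Pi.single 2 1) 5, D (Pi.single 3 1) 5, D (Pi.single 4 1) 5,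
    D (Pi.single 5 1) 5, D (Pi.single 0 1) 6, D (Pi.single 1 1) 6, D (Pi.single 2 1) 6,
    D (Pi.single 3 1) 6, D (Pi.single 4 1) 6, D (Pi.single 5 1) 6, D (Pi.single 6 1) 6]

lemma derivCoords_derivParam : Function.LeftInverse derivCoords derivParam := by
  intro p
  ext k
  fin_cases k <;> simp [derivCoords, derivParam]

lemma derivParam_derivCoords (D : V →ₗ[ℝ] V) (h : IsDeriv D) : derivParam (derivCoords D) = D := by
  rw [isDeriv_iff] at h
  refine end_ext fun j i => ?_
  fin_cases j <;> fin_cases i <;> simp [derivParam, derivCoords] <;> linarith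

/-- The derivations stabilizing `psi`, parametrized by their independent matrix entries. -/
def stabParam : (Fin 4 → ℝ) →ₗ[ℝ] (V →ₗ[ℝ] V) :=
  Matrix.toLin'.toLinearMap ∘ₗ
    { toFun p := !![0, -p 0 + p 3, 0, 0, -p 2, -p 1, 0;
        p 0 - p 3, 0, 0, 0, p 1, -p 2, 0;
        0, 0, 0, -p 0, 0, 0, 0;
        0, 0, p 0, 0, 0, 0, 0;
        p 2, -p 1, 0, 0, 0, -p 3, 0;
        p 1, p 2, 0, 0, p 3, 0, 0;
        0, 0, 0, 0, 0, 0, 0]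
      map_add' p q := by
        ext i j; fin_cases i <;> fin_cases j <;> simp <;> ring
      map_smul' r p := by
        ext i j; fin_cases i <;> fin_cases j <;> simp <;> ring }

/-- The independent matrix entries of a derivation stabilizing `psi`. -/
def stabCoords (D : V →ₗ[ℝ] V) : Fin 4 → ℝ :=
  ![D (Pi.single 2 1) 3, D (Pi.single 0 1) 5, D (Pi.single 1 1) 5, D (Pi.single 4 1) 5]

lemma stabCoords_stabParam : Function.LeftInverse stabCoords stabParam := by
  intro p
  ext k
  fin_cases k <;> simp [stabCoords, stabParam]

lemma isDeriv_stabParam (p : Fin 4 → ℝ) : IsDeriv (stabParam p) := by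
  rw [isDeriv_iff]
  simp [stabParam]

set_option maxHeartbeats 1600000 in
lemma stab4_stabParam {ε : ℝ} {p : Fin 4 → ℝ} (h1 : ε * p 1 = 0) (h2 : ε * p 2 = 0) :
    Stab4 (psi + ε • eta) (stabParam p) := by
  refine stab4_of_basis fun a b c d hab hbc hcd => ?_
  have key : ∀ a b c d : Fin 7, a < b → b < c → c < d →
      (a, b, c, d) ∈ ([(0, 1, 2, 3), (0, 1, 2, 4), (0, 1, 2, 5), (0, 1, 2, 6), (0, 1, 3, 4), (0, 1,
        3, 5), (0, 1, 3, 6), (0, 1, 4, 5), (0, 1, 4, 6), (0, 1, 5, 6), (0, 2, 3, 4), (0, 2, 3, 5),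
        (0, 2, 3, 6), (0, 2, 4, 5), (0, 2, 4, 6), (0, 2, 5, 6), (0, 3, 4, 5), (0, 3, 4, 6), (0, 3,
        5, 6), (0, 4, 5, 6), (1, 2, 3, 4), (1, 2, 3, 5), (1, 2, 3, 6), (1, 2, 4, 5), (1, 2, 4, 6),
        (1, 2, 5, 6), (1, 3, 4, 5), (1, 3, 4, 6), (1, 3, 5, 6), (1, 4, 5, 6), (2, 3, 4, 5), (2, 3,
        4, 6), (2, 3, 5, 6), (2, 4, 5, 6), (3, 4, 5, 6)] : List (Fin 7 × Fin 7 × Fin 7 × Fin 7)) :=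
        by decide
  have hmem := key a b c d hab hbc hcd
  clear key hab hbc hcd
  simp only [List.mem_cons, List.not_mem_nil, or_false, Prod.mk.injEq] at hmem
  rcases hmem with ⟨rfl, rfl, rfl, rfl⟩ | ⟨rfl, rfl, rfl, rfl⟩ | ⟨rfl, rfl, rfl, rfl⟩ | ⟨rfl, rfl,
    rfl, rfl⟩ | ⟨rfl, rfl, rfl, rfl⟩ | ⟨rfl, rfl, rfl, rfl⟩ | ⟨rfl, rfl, rfl, rfl⟩ | ⟨rfl, rfl,
    rfl, rfl⟩ | ⟨rfl, rfl, rfl, rfl⟩ | ⟨rfl, rfl, rfl, rfl⟩ | ⟨rfl, rfl, rfl, rfl⟩ | ⟨rfl, rfl,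
    rfl, rfl⟩ | ⟨rfl, rfl, rfl, rfl⟩ | ⟨rfl, rfl, rfl, rfl⟩ | ⟨rfl, rfl, rfl, rfl⟩ | ⟨rfl, rfl,
    rfl, rfl⟩ | ⟨rfl, rfl, rfl, rfl⟩ | ⟨rfl, rfl, rfl, rfl⟩ | ⟨rfl, rfl, rfl, rfl⟩ | ⟨rfl, rfl,
    rfl, rfl⟩ | ⟨rfl, rfl, rfl, rfl⟩ | ⟨rfl, rfl, rfl, rfl⟩ | ⟨rfl, rfl, rfl, rfl⟩ | ⟨rfl, rfl,
    rfl, rfl⟩ | ⟨rfl, rfl, rfl, rfl⟩ | ⟨rfl, rfl, rfl, rfl⟩ | ⟨rfl, rfl, rfl, rfl⟩ | ⟨rfl, rfl,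
    rfl, rfl⟩ | ⟨rfl, rfl, rfl, rfl⟩ | ⟨rfl, rfl, rfl, rfl⟩ | ⟨rfl, rfl, rfl, rfl⟩ | ⟨rfl, rfl,
    rfl, rfl⟩ | ⟨rfl, rfl, rfl, rfl⟩ | ⟨rfl, rfl, rfl, rfl⟩ | ⟨rfl, rfl, rfl, rfl⟩ <;>
    simp [psi, eta, w4_apply, stabParam] <;>
    first | linarith | simpa using h1 | simpa using h2

set_option maxHeartbeats 1600000 in
/-- The relations from the `e⁷`-component: the induced endomorphism of `ℝ⁶` lies in a copy of `su(3)`. -/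
lemma su3_relations {ε : ℝ} {D : V →ₗ[ℝ] V} (hD : IsDeriv D)
    (hs : Stab4 (psi + ε • eta) D) :
    D (Pi.single 0 1) 0 = 0 ∧
    D (Pi.single 1 1) 0 = -D (Pi.single 2 1) 3 + D (Pi.single 4 1) 5 ∧
    D (Pi.single 2 1) 0 = D (Pi.single 0 1) 2 ∧
    D (Pi.single 3 1) 0 = D (Pi.single 1 1) 2 ∧
    D (Pi.single 4 1) 0 = -D (Pi.single 1 1) 5 ∧
    D (Pi.single 5 1) 0 = -D (Pi.single 0 1) 5 ∧
    D (Pi.single 0 1) 1 = D (Pi.single 2 1) 3 - D (Pi.single 4 1) 5 ∧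
    D (Pi.single 1 1) 1 = 0 ∧
    D (Pi.single 2 1) 1 = D (Pi.single 1 1) 2 ∧
    D (Pi.single 3 1) 1 = -D (Pi.single 0 1) 2 ∧
    D (Pi.single 4 1) 1 = D (Pi.single 0 1) 5 ∧
    D (Pi.single 5 1) 1 = -D (Pi.single 1 1) 5 ∧
    D (Pi.single 2 1) 2 = 0 ∧
    D (Pi.single 3 1) 2 = -D (Pi.single 2 1) 3 ∧
    D (Pi.single 4 1) 2 = -D (Pi.single 3 1) 5 ∧
    D (Pi.single 5 1) 2 = D (Pi.single 2 1) 5 ∧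
    D (Pi.single 0 1) 3 = D (Pi.single 1 1) 2 ∧
    D (Pi.single 1 1) 3 = -D (Pi.single 0 1) 2 ∧
    D (Pi.single 3 1) 3 = 0 ∧
    D (Pi.single 4 1) 3 = D (Pi.single 2 1) 5 ∧
    D (Pi.single 5 1) 3 = D (Pi.single 3 1) 5 ∧
    D (Pi.single 0 1) 4 = D (Pi.single 1 1) 5 ∧
    D (Pi.single 1 1) 4 = -D (Pi.single 0 1) 5 ∧
    D (Pi.single 2 1) 4 = -D (Pi.single 3 1) 5 ∧
    D (Pi.single 3 1) 4 = D (Pi.single 2 1) 5 ∧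
    D (Pi.single 4 1) 4 = 0 ∧
    D (Pi.single 5 1) 4 = -D (Pi.single 4 1) 5 ∧
    D (Pi.single 5 1) 5 = 0 ∧
    D (Pi.single 6 1) 6 = 0 := by
  have key (a b c d : Fin 7) := hs (Pi.single a 1) (Pi.single b 1) (Pi.single c 1) (Pi.single d 1)
  obtain ⟨z0, z1, z2, z3, z4, z5, h01, h02, h03, h04, h05, h12, h13, h14, h15, h23, h24, h25, h34,
    h35, h45⟩ := isDeriv_iff.mp hD
  have s0126 := key 0 1 2 6
  have s0136 := key 0 1 3 6
  have s0146 := key 0 1 4 6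
  have s0156 := key 0 1 5 6
  have s0236 := key 0 2 3 6
  have s0246 := key 0 2 4 6
  have s0256 := key 0 2 5 6
  have s0346 := key 0 3 4 6
  have s0356 := key 0 3 5 6
  have s1236 := key 1 2 3 6
  have s1246 := key 1 2 4 6
  have s1256 := key 1 2 5 6
  have s1346 := key 1 3 4 6
  have s1356 := key 1 3 5 6
  simp [psi, eta, w4_apply, z0, z1, z2, z3, z4, z5]
    at s0126 s0136 s0146 s0156 s0236 s0246 s0256 s0346 s0356 s1236 s1246 s1256 s1346 s1356
  clear key
  refine ⟨?_, ?_, ?_, ?_, ?_, ?_, ?_, ?_, ?_, ?_, ?_, ?_, ?_, ?_, ?_, ?_, ?_, ?_, ?_, ?_, ?_, ?_,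
    ?_, ?_, ?_, ?_, ?_, ?_, ?_⟩ <;> linarith

set_option maxHeartbeats 1600000 in
/-- The relations from the component of the form without `e⁷`. -/
lemma stab_relations {ε : ℝ} (hε : ε ≠ 3 / 2) {D : V →ₗ[ℝ] V} (hD : IsDeriv D)
    (hs : Stab4 (psi + ε • eta) D) :
    D (Pi.single 0 1) 6 = 0 ∧
    D (Pi.single 1 1) 6 = 0 ∧
    D (Pi.single 2 1) 6 = 0 ∧
    D (Pi.single 3 1) 6 = 0 ∧
    D (Pi.single 4 1) 6 = 0 ∧
    D (Pi.single 5 1) 6 = 0 ∧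
    D (Pi.single 2 1) 5 = 0 ∧
    D (Pi.single 3 1) 5 = 0 ∧
    D (Pi.single 0 1) 2 = 0 ∧
    D (Pi.single 1 1) 2 = 0 ∧
    ε * D (Pi.single 0 1) 5 = 0 ∧
    ε * D (Pi.single 1 1) 5 = 0 := by
  have key (a b c d : Fin 7) := hs (Pi.single a 1) (Pi.single b 1) (Pi.single c 1) (Pi.single d 1)
  obtain ⟨r0, r1, r2, r3, r4, r5, r6, r7, r8, r9, r10, r11, r12, r13, r14, r15, r16, r17, r18, r19,
    r20, r21, r22, r23, r24, r25, r26, r27, -⟩ := su3_relations hD hs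
  have s0125 := key 0 1 2 5
  have s0134 := key 0 1 3 4
  have s0124 := key 0 1 2 4
  have s0135 := key 0 1 3 5
  have s0235 := key 0 2 3 5
  have s1234 := key 1 2 3 4
  have s0234 := key 0 2 3 4
  have s1235 := key 1 2 3 5
  have s0345 := key 0 3 4 5
  have s1245 := key 1 2 4 5
  have s0245 := key 0 2 4 5
  have s1345 := key 1 3 4 5
  simp [psi, eta, w4_apply, r0, r1, r2, r3, r4, r5, r6, r7, r8, r9, r10, r11, r12, r13, r14, r15,
    r16, r17, r18, r19, r20, r21, r22, r23, r24, r25, r26, r27]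
    at s0125 s0134 s0124 s0135 s0235 s1234 s0234 s1235 s0345 s1245 s0245 s1345
  have hε' : 3 / 2 - ε ≠ 0 := sub_ne_zero.mpr hε.symm
  have h52 : D (Pi.single 2 1) 5 = 0 := by
    refine (mul_eq_zero.mp ?_).resolve_left hε'
    linarith
  have h53 : D (Pi.single 3 1) 5 = 0 := by
    refine (mul_eq_zero.mp ?_).resolve_left hε'
    linarith
  rw [h52] at s0124 s0135
  rw [h53] at s0125 s0134
  refine ⟨?_, ?_, ?_, ?_, ?_, ?_, h52, h53, ?_, ?_, ?_, ?_⟩ <;> linarith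

lemma stabParam_stabCoords {ε : ℝ} (hε : ε ≠ 3 / 2) {D : V →ₗ[ℝ] V} (hD : IsDeriv D)
    (hs : Stab4 (psi + ε • eta) D) : stabParam (stabCoords D) = D := by
  have h₁ := (isDeriv_iff.mp hD)
  have h₂ := su3_relations hD hs
  have h₃ := stab_relations hε hD hs
  refine end_ext fun j i => ?_
  fin_cases j <;> fin_cases i <;> simp [stabParam, stabCoords, h₁, h₂, h₃]

/-- The derivations stabilizing a small nonzero perturbation of `psi`. -/
def stabParamPerturbed : (Fin 2 → ℝ) →ₗ[ℝ] (V →ₗ[ℝ] V) :=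
  stabParam ∘ₗ
    { toFun p := ![p 0, 0, 0, p 1]
      map_add' p q := by simp
      map_smul' r p := by simp }

/-- The independent matrix entries of a derivation stabilizing the perturbed form. -/
def stabCoordsPerturbed (D : V →ₗ[ℝ] V) : Fin 2 → ℝ :=
  ![stabCoords D 0, stabCoords D 3]

lemma stabCoordsPerturbed_stabParamPerturbed :
    Function.LeftInverse stabCoordsPerturbed stabParamPerturbed := by
  intro p
  simp only [stabCoordsPerturbed, stabParamPerturbed, LinearMap.comp_apply, stabCoords_stabParam _]
  ext k
  fin_cases k <;> simp

lemma stabParamPerturbed_stabCoordsPerturbed {ε : ℝ} (h₀ : ε ≠ 0) (hε : ε ≠ 3 / 2)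
    {D : V →ₗ[ℝ] V} (hD : IsDeriv D) (hs : Stab4 (psi + ε • eta) D) :
    stabParamPerturbed (stabCoordsPerturbed D) = D := by
  obtain ⟨-, -, -, -, -, -, -, -, -, -, h₁, h₂⟩ := stab_relations hε hD hs
  rw [← stabParam_stabCoords hε hD hs, stabParamPerturbed, LinearMap.comp_apply,
    stabCoordsPerturbed, stabCoords_stabParam]
  congr 1
  ext k
  fin_cases k <;> simp_all [stabCoords]

theorem statement_14 :
    (∃ Z : Submodule ℝ (AlternatingMap ℝ V ℝ (Fin 4)),
      (∀ ψ, ψ ∈ Z ↔ Closed4 ψ) ∧ Module.finrank ℝ Z = 29) ∧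
    (∃ W : Submodule ℝ (V →ₗ[ℝ] V),
      (∀ D, D ∈ W ↔ IsDeriv D) ∧ Module.finrank ℝ W = 28) ∧
    Closed4 psi ∧
    (∃ S : Submodule ℝ (V →ₗ[ℝ] V),
      (∀ D, D ∈ S ↔ IsDeriv D ∧ Stab4 psi D) ∧ Module.finrank ℝ S = 4) ∧
    (∃ δ : ℝ, 0 < δ ∧ ∀ ε : ℝ, 0 < |ε| → |ε| < δ →
      ∃ S : Submodule ℝ (V →ₗ[ℝ] V),
        (∀ D, D ∈ S ↔ IsDeriv D ∧ Stab4 (psi + ε • eta) D) ∧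
        Module.finrank ℝ S = 2) := by
  refine ⟨⟨_, fun _ => mem_ker_d4Coords, finrank_ker_d4Coords⟩,
    exists_submodule_of_param derivParam derivCoords derivCoords_derivParam isDeriv_derivParam
      derivParam_derivCoords,
    closed4_psi, ?_, 1, one_pos, fun ε h₀ h₁ => ?_⟩
  · have hpsi : psi + (0 : ℝ) • eta = psi := by simp
    rw [← hpsi]
    exact exists_submodule_of_param stabParam stabCoords stabCoords_stabParam
      (fun p => ⟨isDeriv_stabParam p, stab4_stabParam (zero_mul _) (zero_mul _)⟩)
      fun D h => stabParam_stabCoords (by norm_num) h.1 h.2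
  · have hε : ε ≠ 3 / 2 := (show ε < 3 / 2 by linarith [le_abs_self ε]).ne
    exact exists_submodule_of_param stabParamPerturbed stabCoordsPerturbed
      stabCoordsPerturbed_stabParamPerturbed
      (fun p => ⟨isDeriv_stabParam _, stab4_stabParam (mul_zero _) (mul_zero _)⟩)
      fun D h => stabParamPerturbed_stabCoordsPerturbed (abs_pos.mp h₀) hε h.1 h.2
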